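/- arXiv:1512.09091 — 3 statements merged into one kernel-verified Lean document; each statement's English description precedes it below -/
import Mathlib

section
/- Fix d ≥ 1. Let φ : ℝ^d → ℝ be a nonnegative integrable radially symmetric function (φ(y₁) = φ(y₂) whenever |y₁| = |y₂|) with support contained in the closed unit ball B̄₁ of ℝ^d and normalized so that ∫_{ℝ^d} |y|² φ(y) dy = d. Let M be a symmetric positive definite d×d real matrix, ε > 0, and let w(x) = xᵀAx + bᵀx + c be a quadratic polynomial (A a d×d real matrix, b ∈ ℝ^d, c ∈ ℝ). Then for every x ∈ ℝ^d, I_ε^M w(x) = tr(M(A + Aᵀ)M) = M² : D²w(x), i.e., the integral operator is exactly consistent on quadratic polynomials, for every ε > 0. -/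
open MeasureTheory Matrix

/-- The centered second difference `𝔡w(x,y) = w(x+y) - 2w(x) + w(x-y)`. -/
noncomputable def centeredSecondDiff {d : ℕ} (w : EuclideanSpace ℝ (Fin d) → ℝ)
    (x y : EuclideanSpace ℝ (Fin d)) : ℝ :=
  w (x + y) - 2 * w x + w (x - y)

/-- The integral operator
`I_ε^M w(x) := (ε^{d+2} det M)⁻¹ ∫ 𝔡w(x,y) φ(M⁻¹y/ε) dy`. -/
noncomputable def intOp {d : ℕ} (φ : EuclideanSpace ℝ (Fin d) → ℝ) (ε : ℝ)
    (M : Matrix (Fin d) (Fin d) ℝ) (w : EuclideanSpace ℝ (Fin d) → ℝ)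
    (x : EuclideanSpace ℝ (Fin d)) : ℝ :=
  (ε ^ (d + 2) * M.det)⁻¹ *
    ∫ y : EuclideanSpace ℝ (Fin d),
      centeredSecondDiff w x y * φ (ε⁻¹ • Matrix.toEuclideanLin M⁻¹ y)

theorem integrable_coord_mul_coord_mul {ι : Type*} [Fintype ι] {φ : EuclideanSpace ℝ ι → ℝ}
    (hφint : Integrable φ) (hφsupp : Function.support φ ⊆ Metric.closedBall 0 1) (i j : ι) :
    Integrable fun y : EuclideanSpace ℝ ι => y i * y j * φ y := by
  refine hφint.mono (by fun_prop) (.of_forall fun y => ?_)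
  by_cases hy : φ y = 0
  · simp [hy]
  · have hball : ‖y‖ ≤ 1 := by simpa using hφsupp hy
    have hi : ‖y i‖ ≤ 1 := (PiLp.norm_apply_le y i).trans hball
    have hj : ‖y j‖ ≤ 1 := (PiLp.norm_apply_le y j).trans hball
    rw [norm_mul, norm_mul]
    exact mul_le_of_le_one_left (norm_nonneg _) (mul_le_one₀ hi (norm_nonneg _) hj)

/-- Radial weights have vanishing mixed second moments. -/
theorem integral_coord_mul_coord_mul_of_ne {ι : Type*} [Fintype ι] {φ : EuclideanSpace ℝ ι → ℝ}
    (hφrad : ∀ y₁ y₂ : EuclideanSpace ℝ ι, ‖y₁‖ = ‖y₂‖ → φ y₁ = φ y₂) {i j : ι} (hij : i ≠ j) :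
    ∫ y : EuclideanSpace ℝ ι, y i * y j * φ y = 0 := by
  classical
  let e : EuclideanSpace ℝ ι ≃ₗᵢ[ℝ] EuclideanSpace ℝ ι :=
    LinearIsometryEquiv.piLpCongrRight 2 fun k =>
      if k = i then LinearIsometryEquiv.neg ℝ else LinearIsometryEquiv.refl ℝ ℝ
  have h := e.measurePreserving.integral_comp e.toHomeomorph.measurableEmbedding
    fun y : EuclideanSpace ℝ ι => y i * y j * φ y
  have hneg (y : EuclideanSpace ℝ ι) : e y i * e y j * φ (e y) = -(y i * y j * φ y) := by
    rw [hφrad (e y) y (e.norm_map y)]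
    simp [e, hij.symm]
  simp only [hneg, integral_neg] at h
  linarith

/-- The diagonal second moments of a radial weight all agree. -/
theorem integral_coord_mul_self_mul_eq {ι : Type*} [Fintype ι] {φ : EuclideanSpace ℝ ι → ℝ}
    (hφrad : ∀ y₁ y₂ : EuclideanSpace ℝ ι, ‖y₁‖ = ‖y₂‖ → φ y₁ = φ y₂) (i j : ι) :
    ∫ y : EuclideanSpace ℝ ι, y i * y i * φ y = ∫ y : EuclideanSpace ℝ ι, y j * y j * φ y := by
  classical
  let e : EuclideanSpace ℝ ι ≃ₗᵢ[ℝ] EuclideanSpace ℝ ι :=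
    LinearIsometryEquiv.piLpCongrLeft 2 ℝ ℝ (Equiv.swap i j)
  rw [← e.measurePreserving.integral_comp e.toHomeomorph.measurableEmbedding
    fun y : EuclideanSpace ℝ ι => y i * y i * φ y]
  refine integral_congr_ae (.of_forall fun y => ?_)
  have hi : e y i = y j := by simp [e, LinearIsometryEquiv.piLpCongrLeft_apply]
  simp only [hφrad (e y) y (e.norm_map y), hi]

theorem integral_coord_mul_coord_mul {ι : Type*} [Fintype ι] [DecidableEq ι]
    {φ : EuclideanSpace ℝ ι → ℝ} (hφint : Integrable φ)
    (hφrad : ∀ y₁ y₂ : EuclideanSpace ℝ ι, ‖y₁‖ = ‖y₂‖ → φ y₁ = φ y₂)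
    (hφsupp : Function.support φ ⊆ Metric.closedBall 0 1)
    (hφnorm : (∫ y : EuclideanSpace ℝ ι, ‖y‖ ^ 2 * φ y) = Fintype.card ι) (i j : ι) :
    ∫ y : EuclideanSpace ℝ ι, y i * y j * φ y = (1 : Matrix ι ι ℝ) i j := by
  obtain rfl | hij := eq_or_ne i j
  · have hsum : ∑ k, ∫ y : EuclideanSpace ℝ ι, y k * y k * φ y = Fintype.card ι := by
      rw [← hφnorm, ← integral_finsetSum _ fun k _ =>
        integrable_coord_mul_coord_mul hφint hφsupp k k]
      simp only [EuclideanSpace.real_norm_sq_eq, Finset.sum_mul]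
      simp only [pow_two]
    simp only [integral_coord_mul_self_mul_eq hφrad _ i, Finset.sum_const, Finset.card_univ,
      nsmul_eq_mul] at hsum
    have hcard : (Fintype.card ι : ℝ) ≠ 0 := by
      have : Nonempty ι := ⟨i⟩
      exact_mod_cast Fintype.card_ne_zero
    rw [Matrix.one_apply_eq]
    exact mul_left_cancel₀ hcard (by rw [hsum, mul_one])
  · rw [integral_coord_mul_coord_mul_of_ne hφrad hij, Matrix.one_apply_ne hij]

/-- Integrating a quadratic form against a normalized radial weight gives its trace. -/
theorem integral_dotProduct_mulVec_mul {ι : Type*} [Fintype ι] {φ : EuclideanSpace ℝ ι → ℝ}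
    (hφint : Integrable φ)
    (hφrad : ∀ y₁ y₂ : EuclideanSpace ℝ ι, ‖y₁‖ = ‖y₂‖ → φ y₁ = φ y₂)
    (hφsupp : Function.support φ ⊆ Metric.closedBall 0 1)
    (hφnorm : (∫ y : EuclideanSpace ℝ ι, ‖y‖ ^ 2 * φ y) = Fintype.card ι) (B : Matrix ι ι ℝ) :
    ∫ y : EuclideanSpace ℝ ι, (y.ofLp ⬝ᵥ B *ᵥ y.ofLp) * φ y = B.trace := by
  classical
  have hint (i j : ι) := (integrable_coord_mul_coord_mul hφint hφsupp i j).const_mul (B i j)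
  have hexpand (y : EuclideanSpace ℝ ι) :
      (y.ofLp ⬝ᵥ B *ᵥ y.ofLp) * φ y = ∑ i, ∑ j, B i j * (y i * y j * φ y) := by
    simp only [dotProduct, mulVec, Finset.mul_sum, Finset.sum_mul]
    exact Finset.sum_congr rfl fun i _ => Finset.sum_congr rfl fun j _ => by ring
  simp only [hexpand]
  rw [integral_finsetSum _ fun i _ => integrable_finsetSum _ fun j _ => hint i j]
  simp only [integral_finsetSum _ fun j _ => hint _ j, integral_const_mul,
    integral_coord_mul_coord_mul hφint hφrad hφsupp hφnorm]
  simp [Matrix.one_apply, Matrix.trace]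

/-- Linear change of variables for the Bochner integral. -/
theorem integral_comp_linearMap_of_det_ne_zero {E : Type*} [NormedAddCommGroup E] [NormedSpace ℝ E]
    [FiniteDimensional ℝ E] [MeasurableSpace E] [BorelSpace E] (μ : Measure E) [μ.IsAddHaarMeasure]
    {f : E →ₗ[ℝ] E} (hf : LinearMap.det f ≠ 0) (g : E → ℝ) :
    ∫ y, g (f y) ∂μ = |(LinearMap.det f)⁻¹| * ∫ z, g z ∂μ := by
  let e := (LinearMap.equivOfDetNeZero f hf).toContinuousLinearEquiv
  have he : MeasurableEmbedding f := e.toHomeomorph.measurableEmbedding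
  rw [← he.integral_map, Measure.map_linearMap_addHaar_eq_smul_addHaar μ hf, integral_smul_measure,
    ENNReal.toReal_ofReal (abs_nonneg _), smul_eq_mul]

/-- The second difference of a quadratic polynomial does not depend on the base point. -/
theorem centeredSecondDiff_quadratic {d : ℕ} {w : EuclideanSpace ℝ (Fin d) → ℝ}
    {A : Matrix (Fin d) (Fin d) ℝ} {b : Fin d → ℝ} {c : ℝ}
    (hw : ∀ x, w x = (∑ i, ∑ j, x i * A i j * x j) + (∑ i, b i * x i) + c)
    (x y : EuclideanSpace ℝ (Fin d)) :
    centeredSecondDiff w x y = y.ofLp ⬝ᵥ (A + Aᵀ) *ᵥ y.ofLp := by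
  have hquad (v : EuclideanSpace ℝ (Fin d)) :
      w v = v.ofLp ⬝ᵥ A *ᵥ v.ofLp + b ⬝ᵥ v.ofLp + c := by
    simp only [hw, dotProduct, mulVec, Finset.mul_sum, mul_assoc]
  have htranspose : y.ofLp ⬝ᵥ Aᵀ *ᵥ y.ofLp = y.ofLp ⬝ᵥ A *ᵥ y.ofLp := by
    rw [mulVec_transpose, dotProduct_comm, dotProduct_mulVec]
  simp only [centeredSecondDiff, hquad, WithLp.ofLp_add, WithLp.ofLp_sub, mulVec_add, mulVec_sub,
    add_mulVec, dotProduct_add, dotProduct_sub, add_dotProduct, sub_dotProduct, htranspose]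
  ring

/-- Exact consistency of the integral operator on quadratic polynomials:
if `w(x) = xᵀAx + bᵀx + c`, then `I_ε^M w(x) = tr(M(A+Aᵀ)M) = M² : D²w` for every `ε > 0`. -/
theorem intOp_quadratic (d : ℕ) (hd : 1 ≤ d)
    (φ : EuclideanSpace ℝ (Fin d) → ℝ)
    (hφ0 : ∀ y, 0 ≤ φ y)
    (hφint : Integrable φ)
    (hφrad : ∀ y₁ y₂ : EuclideanSpace ℝ (Fin d), ‖y₁‖ = ‖y₂‖ → φ y₁ = φ y₂)
    (hφsupp : Function.support φ ⊆ Metric.closedBall 0 1)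
    (hφnorm : (∫ y : EuclideanSpace ℝ (Fin d), ‖y‖ ^ 2 * φ y) = d)
    (M : Matrix (Fin d) (Fin d) ℝ) (hMsym : M.IsSymm) (hMpos : M.PosDef)
    (ε : ℝ) (hε : 0 < ε)
    (A : Matrix (Fin d) (Fin d) ℝ) (b : Fin d → ℝ) (c : ℝ)
    (w : EuclideanSpace ℝ (Fin d) → ℝ)
    (hw : ∀ x, w x = (∑ i, ∑ j, x i * A i j * x j) + (∑ i, b i * x i) + c) :
    ∀ x : EuclideanSpace ℝ (Fin d),
      intOp φ ε M w x = Matrix.trace (M * (A + Aᵀ) * M) ∧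
      Matrix.trace (M * (A + Aᵀ) * M) = ∑ i, ∑ j, (M * M) i j * (A + Aᵀ) i j := by
  intro x
  have hdet : M.det ≠ 0 := hMpos.det_pos.ne'
  have hunit : IsUnit M.det := hdet.isUnit
  have hε0 : ε ≠ 0 := hε.ne'
  refine ⟨?_, ?_⟩
  · set f : EuclideanSpace ℝ (Fin d) →ₗ[ℝ] EuclideanSpace ℝ (Fin d) :=
      ε⁻¹ • Matrix.toEuclideanLin M⁻¹ with hf
    have hfdet : LinearMap.det f = (ε ^ d * M.det)⁻¹ := by
      rw [hf, LinearMap.det_smul, LinearMap.det_toLpLin, finrank_euclideanSpace_fin,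
        Matrix.det_nonsing_inv, Ring.inverse_eq_inv', mul_inv, inv_pow]
    have hfdet0 : LinearMap.det f ≠ 0 := by
      rw [hfdet]
      exact inv_ne_zero (mul_ne_zero (pow_ne_zero _ hε0) hdet)
    have hinv (y : EuclideanSpace ℝ (Fin d)) : y.ofLp = (ε • M) *ᵥ (f y).ofLp := by
      simp [hf, smul_mulVec, mulVec_smul, smul_smul, hε0, Matrix.mul_nonsing_inv _ hunit]
    have hintegrand (y : EuclideanSpace ℝ (Fin d)) :
        centeredSecondDiff w x y * φ (ε⁻¹ • Matrix.toEuclideanLin M⁻¹ y) =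
          ((f y).ofLp ⬝ᵥ (ε ^ 2 • (M * (A + Aᵀ) * M)) *ᵥ (f y).ofLp) * φ (f y) := by
      have hconj : ε ^ 2 • (M * (A + Aᵀ) * M) = (ε • M)ᵀ * (A + Aᵀ) * (ε • M) := by
        rw [transpose_smul, hMsym.eq, Matrix.smul_mul, Matrix.smul_mul, Matrix.mul_smul, smul_smul,
          pow_two]
      rw [centeredSecondDiff_quadratic hw, hinv y, hconj, ← mulVec_mulVec, ← mulVec_mulVec,
        dotProduct_mulVec (f y).ofLp, vecMul_transpose]
      rfl
    have hpos : 0 < ε ^ d * M.det := mul_pos (pow_pos hε d) hMpos.det_pos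
    rw [intOp, integral_congr_ae (.of_forall hintegrand),
      integral_comp_linearMap_of_det_ne_zero volume hfdet0 fun z =>
        (z.ofLp ⬝ᵥ (ε ^ 2 • (M * (A + Aᵀ) * M)) *ᵥ z.ofLp) * φ z,
      integral_dotProduct_mulVec_mul hφint hφrad hφsupp (by simpa using hφnorm), hfdet, inv_inv,
      abs_of_pos hpos, Matrix.trace_smul, smul_eq_mul]
    field_simp
    ring
  · rw [Matrix.trace_mul_comm, ← Matrix.mul_assoc, Matrix.trace]
    simp only [Matrix.diag_apply, Matrix.mul_apply (M := M * M)]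
    refine Finset.sum_congr rfl fun i _ => Finset.sum_congr rfl fun j _ => ?_
    simp [add_comm]
end

section
/- Fix d ≥ 1. Let φ : ℝ^d → ℝ be a nonnegative integrable radially symmetric function (φ(y₁) = φ(y₂) whenever |y₁| = |y₂|) with support contained in the closed unit ball B̄₁ of ℝ^d. There is a constant C, depending only on d and φ, with the following property. Let M : ℝ^d → (symmetric positive definite d×d real matrices) and let ϖ : [0,∞) → [0,∞) be nondecreasing with ‖M(x₁) − M(x₂)‖ ≤ ϖ(|x₁ − x₂|) for all x₁, x₂ ∈ ℝ^d (operator norm). Then for every ε > 0, every L-Lipschitz bounded function w : ℝ^d → ℝ, and every x, z ∈ ℝ^d: |I_ε^{M(x)} w(x) − I_ε^{M(z)} w(z)| ≤ C · L · ( |x − z| / ε² + ϖ(|x − z|) / ε ). -/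
open MeasureTheory Matrix

/-- The linear change of variables `y = ε M u` gives `I_ε^M w(x) = ε⁻² ∫ 𝔡w(x, ε M u) φ(u) du`. -/
theorem intOp_eq_integral {d : ℕ} (φ : EuclideanSpace ℝ (Fin d) → ℝ) {ε : ℝ} (hε : 0 < ε)
    {M : Matrix (Fin d) (Fin d) ℝ} (hM : 0 < M.det) (w : EuclideanSpace ℝ (Fin d) → ℝ)
    (x : EuclideanSpace ℝ (Fin d)) :
    intOp φ ε M w x = (ε ^ 2)⁻¹ *
      ∫ u, centeredSecondDiff w x (ε • Matrix.toEuclideanCLM (𝕜 := ℝ) M u) * φ u := by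
  set T : EuclideanSpace ℝ (Fin d) →L[ℝ] EuclideanSpace ℝ (Fin d) :=
    ε • Matrix.toEuclideanCLM (𝕜 := ℝ) M with hT
  have hinv (u) : ε⁻¹ • Matrix.toEuclideanLin M⁻¹ (T u) = u := by
    have h : Matrix.toEuclideanLin M⁻¹ (Matrix.toEuclideanCLM (𝕜 := ℝ) M u) = u := by
      ext i
      simp [Matrix.toLpLin_apply, Matrix.ofLp_toEuclideanCLM, Matrix.mulVec_mulVec,
        Matrix.nonsing_inv_mul M hM.ne'.isUnit]
    simp [hT, h, smul_smul, hε.ne']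
  have hdet : T.det = ε ^ d * M.det := by
    have h : (T : EuclideanSpace ℝ (Fin d) →ₗ[ℝ] EuclideanSpace ℝ (Fin d)) =
        ε • Matrix.toLpLin 2 2 M := rfl
    rw [ContinuousLinearMap.det, h, LinearMap.det_smul, finrank_euclideanSpace_fin,
      Matrix.toLpLin_eq_toLin, LinearMap.det_toLin]
  have hinj : Function.Injective T :=
    Function.LeftInverse.injective (g := fun y => ε⁻¹ • Matrix.toEuclideanLin M⁻¹ y) hinv
  have hsurj : Function.Surjective T :=
    LinearMap.surjective_of_injective (f := T.toLinearMap) hinj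
  have key := integral_image_eq_integral_abs_det_fderiv_smul volume MeasurableSet.univ
    (fun u _ => T.hasFDerivAt.hasFDerivWithinAt) hinj.injOn
    (fun y => centeredSecondDiff w x y * φ (ε⁻¹ • Matrix.toEuclideanLin M⁻¹ y))
  have hpos : 0 < ε ^ d * M.det := by positivity
  simp only [Set.image_univ, hsurj.range_eq, setIntegral_univ, hinv, hdet, abs_of_pos hpos,
    smul_eq_mul, integral_const_mul] at key
  rw [intOp, key, ← mul_assoc]
  congr 1
  field_simp
  ring

/-- Lipschitz bound for the centered second difference in both arguments. -/
theorem abs_centeredSecondDiff_sub_le {d : ℕ} {w : EuclideanSpace ℝ (Fin d) → ℝ} {L : ℝ}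
    (hL : 0 ≤ L) (hw : ∀ x₁ x₂, |w x₁ - w x₂| ≤ L * dist x₁ x₂)
    (x z a b : EuclideanSpace ℝ (Fin d)) :
    |centeredSecondDiff w x a - centeredSecondDiff w z b| ≤
      L * (4 * dist x z + 2 * dist a b) := by
  have h₁ := (hw (x + a) (z + b)).trans
    (mul_le_mul_of_nonneg_left (dist_add_add_le x a z b) hL)
  have h₂ := (hw (x - a) (z - b)).trans
    (mul_le_mul_of_nonneg_left (dist_sub_sub_le x a z b) hL)
  have h₃ := hw x z
  rw [abs_le] at *
  constructor <;> simp only [centeredSecondDiff] <;> linarith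

/-- Second differences of a bounded continuous function are integrable against an integrable
kernel. -/
theorem integrable_centeredSecondDiff_mul {d : ℕ} {φ : EuclideanSpace ℝ (Fin d) → ℝ}
    (hφ : Integrable φ) {w : EuclideanSpace ℝ (Fin d) → ℝ} (hw : Continuous w) {B : ℝ}
    (hB : ∀ x, |w x| ≤ B) (x : EuclideanSpace ℝ (Fin d))
    {f : EuclideanSpace ℝ (Fin d) → EuclideanSpace ℝ (Fin d)} (hf : Continuous f) :
    Integrable fun u => centeredSecondDiff w x (f u) * φ u := by
  refine hφ.bdd_mul (c := 4 * B) ?_ (ae_of_all _ fun u => ?_)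
  · unfold centeredSecondDiff
    exact Continuous.aestronglyMeasurable (by fun_prop)
  · have h₁ := hB (x + f u)
    have h₂ := hB (x - f u)
    have h₃ := hB x
    rw [Real.norm_eq_abs]
    rw [abs_le] at *
    constructor <;> simp only [centeredSecondDiff] <;> linarith

/-- Continuity of the integral operator: for a Lipschitz function `w` and a coefficient
field `x ↦ M(x)` with modulus of continuity `ϖ`,
`|I_ε^{M(x)} w(x) − I_ε^{M(z)} w(z)| ≤ C L (|x−z|/ε² + ϖ(|x−z|)/ε)`,
with `C` depending only on `d` and `φ`. -/
theorem intOp_continuity (d : ℕ) (hd : 1 ≤ d)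
    (φ : EuclideanSpace ℝ (Fin d) → ℝ)
    (hφ0 : ∀ y, 0 ≤ φ y)
    (hφint : Integrable φ)
    (hφrad : ∀ y₁ y₂ : EuclideanSpace ℝ (Fin d), ‖y₁‖ = ‖y₂‖ → φ y₁ = φ y₂)
    (hφsupp : Function.support φ ⊆ Metric.closedBall 0 1) :
    ∃ C : ℝ, 0 < C ∧
      ∀ (M : EuclideanSpace ℝ (Fin d) → Matrix (Fin d) (Fin d) ℝ),
        (∀ x, (M x).IsSymm ∧ (M x).PosDef) →
        ∀ ϖ : ℝ → ℝ, Monotone ϖ → (∀ t, 0 ≤ ϖ t) →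
        (∀ x₁ x₂ : EuclideanSpace ℝ (Fin d),
          ‖Matrix.toEuclideanCLM (𝕜 := ℝ) (M x₁ - M x₂)‖ ≤ ϖ (dist x₁ x₂)) →
        ∀ ε : ℝ, 0 < ε →
        ∀ (L : ℝ), 0 ≤ L →
        ∀ w : EuclideanSpace ℝ (Fin d) → ℝ,
          (∃ B : ℝ, ∀ x, |w x| ≤ B) →
          (∀ x₁ x₂ : EuclideanSpace ℝ (Fin d), |w x₁ - w x₂| ≤ L * dist x₁ x₂) →
          ∀ x z : EuclideanSpace ℝ (Fin d),
            |intOp φ ε (M x) w x - intOp φ ε (M z) w z| ≤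
              C * L * (dist x z / ε ^ 2 + ϖ (dist x z) / ε) := by
  have hI : 0 ≤ ∫ u, φ u := integral_nonneg hφ0
  refine ⟨4 * (∫ u, φ u) + 1, by positivity, ?_⟩
  rintro M hM ϖ - hϖ0 hϖ ε hε L hL w ⟨B, hB⟩ hw x z
  have hwc : Continuous w :=
    (LipschitzWith.of_dist_le_mul (K := ⟨L, hL⟩) hw).continuous
  rw [intOp_eq_integral φ hε (hM x).2.det_pos, intOp_eq_integral φ hε (hM z).2.det_pos,
    ← mul_sub, ← integral_sub
      (integrable_centeredSecondDiff_mul hφint hwc hB x (by fun_prop))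
      (integrable_centeredSecondDiff_mul hφint hwc hB z (by fun_prop)),
    abs_mul, abs_of_pos (by positivity)]
  have hbound (u : EuclideanSpace ℝ (Fin d)) :
      ‖centeredSecondDiff w x (ε • Matrix.toEuclideanCLM (𝕜 := ℝ) (M x) u) * φ u -
        centeredSecondDiff w z (ε • Matrix.toEuclideanCLM (𝕜 := ℝ) (M z) u) * φ u‖ ≤
      L * (4 * dist x z + 2 * (ε * ϖ (dist x z))) * φ u := by
    rw [← sub_mul, norm_mul, Real.norm_eq_abs, Real.norm_of_nonneg (hφ0 u)]
    by_cases hu : φ u = 0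
    · simp [hu]
    have hu1 : ‖u‖ ≤ 1 := by simpa using hφsupp hu
    have hdist : dist (ε • Matrix.toEuclideanCLM (𝕜 := ℝ) (M x) u)
        (ε • Matrix.toEuclideanCLM (𝕜 := ℝ) (M z) u) ≤ ε * ϖ (dist x z) := by
      rw [dist_eq_norm, ← smul_sub, norm_smul, Real.norm_of_nonneg hε.le,
        ← _root_.sub_apply, ← map_sub]
      gcongr
      exact (ContinuousLinearMap.le_of_opNorm_le _ (hϖ x z) u).trans
        (mul_le_of_le_one_right (hϖ0 _) hu1)
    gcongr
    · exact hφ0 u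
    · exact (abs_centeredSecondDiff_sub_le hL hw x z _ _).trans (by gcongr)
  have hint := norm_integral_le_of_norm_le (hφint.const_mul _) (ae_of_all _ hbound)
  rw [integral_const_mul, Real.norm_eq_abs] at hint
  set r := ϖ (dist x z)
  have hr : 0 ≤ r := hϖ0 _
  calc
    _ ≤ (ε ^ 2)⁻¹ * (L * (4 * dist x z + 2 * (ε * r)) * ∫ u, φ u) := by gcongr
    _ = L * ((4 * ∫ u, φ u) * (dist x z / ε ^ 2) + (2 * ∫ u, φ u) * (r / ε)) := by
      field_simp
    _ ≤ L * ((4 * (∫ u, φ u) + 1) * (dist x z / ε ^ 2) +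
        (4 * (∫ u, φ u) + 1) * (r / ε)) := by
      gcongr <;> linarith
    _ = _ := by ring
end

section
/- Fix d ≥ 1. Let φ : ℝ^d → ℝ be a nonnegative integrable radially symmetric function (φ(y₁) = φ(y₂) whenever |y₁| = |y₂|) with support contained in the closed unit ball B̄₁ of ℝ^d. Let ξ₁, …, ξ_ν ∈ B̄₁ and ω₁, …, ω_ν ≥ 0 be quadrature nodes and weights such that Σ_{j=1}^{ν} ω_j q(ξ_j) φ(ξ_j) = ∫_{B₁} q(y) φ(y) dy for every polynomial q on ℝ^d of degree at most 2. Let M be a symmetric positive definite d×d real matrix, ε > 0, s ∈ (0,1], K ≥ 0, x ∈ ℝ^d, and let w : ℝ^d → ℝ be bounded and measurable. Suppose there exists a quadratic polynomial P on ℝ^d such that |w(y) − P(y)| ≤ K ε^{2+s} for every y with |y − x| ≤ ε‖M‖ (operator norm). Then |Ĩ_ε^M w(x) − I_{ε,h}^M w(x)| ≤ 8 K ε^{s} ∫_{B₁} φ(y) dy. -/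
open MeasureTheory Matrix

/-- The ball form of the integral operator:
`Ĩ_ε^M w(x) := (2/ε²) ∫_{B₁} (w(x + εMy) − w(x)) φ(y) dy`. -/
noncomputable def intOpBall {d : ℕ} (φ : EuclideanSpace ℝ (Fin d) → ℝ) (ε : ℝ)
    (M : Matrix (Fin d) (Fin d) ℝ) (w : EuclideanSpace ℝ (Fin d) → ℝ)
    (x : EuclideanSpace ℝ (Fin d)) : ℝ :=
  2 / ε ^ 2 *
    ∫ y in Metric.ball (0 : EuclideanSpace ℝ (Fin d)) 1,
      (w (x + ε • Matrix.toEuclideanLin M y) - w x) * φ y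

/-- The quadrature approximation of the integral operator:
`I_{ε,h}^M w(x) := (2/ε²) Σⱼ ωⱼ (w(x + εMξⱼ) − w(x)) φ(ξⱼ)`. -/
noncomputable def intOpQuad {d ν : ℕ} (φ : EuclideanSpace ℝ (Fin d) → ℝ)
    (ξ : Fin ν → EuclideanSpace ℝ (Fin d)) (ω : Fin ν → ℝ) (ε : ℝ)
    (M : Matrix (Fin d) (Fin d) ℝ) (w : EuclideanSpace ℝ (Fin d) → ℝ)
    (x : EuclideanSpace ℝ (Fin d)) : ℝ :=
  2 / ε ^ 2 * ∑ j, ω j * (w (x + ε • Matrix.toEuclideanLin M (ξ j)) - w x) * φ (ξ j)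

/-- The class of quadratic polynomials is stable under composition with affine maps. -/
theorem exists_quadratic_comp_affine {d : ℕ} (Q M : Matrix (Fin d) (Fin d) ℝ) (b : Fin d → ℝ)
    (c ε : ℝ) (x : EuclideanSpace ℝ (Fin d)) :
    ∃ (Q' : Matrix (Fin d) (Fin d) ℝ) (b' : Fin d → ℝ) (c' : ℝ),
      ∀ y : EuclideanSpace ℝ (Fin d),
        (∑ i, ∑ k, (x + ε • Matrix.toEuclideanLin M y) i * Q i k *
          (x + ε • Matrix.toEuclideanLin M y) k) +
          (∑ i, b i * (x + ε • Matrix.toEuclideanLin M y) i) + c =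
        (∑ i, ∑ k, y i * Q' i k * y k) + (∑ i, b' i * y i) + c' := by
  have form (A : Matrix (Fin d) (Fin d) ℝ) (v : Fin d → ℝ) :
      ∑ i, ∑ k, v i * A i k * v k = v ⬝ᵥ A *ᵥ v := by
    simp only [dotProduct, mulVec, Finset.mul_sum, mul_assoc]
  have lin (a v : Fin d → ℝ) : ∑ i, a i * v i = a ⬝ᵥ v := rfl
  refine ⟨ε ^ 2 • (Mᵀ * Q * M),
    ε • ((x.ofLp ᵥ* Q) ᵥ* M + (Q *ᵥ x.ofLp) ᵥ* M + b ᵥ* M),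
    x.ofLp ⬝ᵥ Q *ᵥ x.ofLp + b ⬝ᵥ x.ofLp + c, fun y => ?_⟩
  have key : ∀ z : EuclideanSpace ℝ (Fin d), (Matrix.toEuclideanLin M z).ofLp = M *ᵥ z.ofLp :=
    fun z => rfl
  rw [form, form, lin, lin, WithLp.ofLp_add, WithLp.ofLp_smul, key]
  have h1 : y.ofLp ⬝ᵥ (Mᵀ * Q * M) *ᵥ y.ofLp = (M *ᵥ y.ofLp) ⬝ᵥ Q *ᵥ (M *ᵥ y.ofLp) := by
    rw [← mulVec_mulVec, ← mulVec_mulVec, dotProduct_mulVec, vecMul_transpose]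
  have h2 : (M *ᵥ y.ofLp) ⬝ᵥ Q *ᵥ x.ofLp = ((Q *ᵥ x.ofLp) ᵥ* M) ⬝ᵥ y.ofLp := by
    rw [dotProduct_comm, dotProduct_mulVec]
  have h3 : x.ofLp ⬝ᵥ Q *ᵥ (M *ᵥ y.ofLp) = ((x.ofLp ᵥ* Q) ᵥ* M) ⬝ᵥ y.ofLp := by
    rw [dotProduct_mulVec, dotProduct_mulVec]
  simp only [mulVec_add, mulVec_smul, smul_mulVec, dotProduct_add, add_dotProduct,
    dotProduct_smul, smul_dotProduct, smul_eq_mul, h1, h2, h3]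
  rw [dotProduct_mulVec b M]
  ring

/-- Effect of quadrature: if the quadrature rule is exact for quadratics (against the
weight `φ`), and `w` is approximated by a quadratic polynomial `P` to order `K ε^{2+s}`
near `x`, then `|Ĩ_ε^M w(x) − I_{ε,h}^M w(x)| ≤ 8 K ε^s ∫_{B₁} φ`. -/
theorem intOp_quadrature_error (d : ℕ) (hd : 1 ≤ d)
    (φ : EuclideanSpace ℝ (Fin d) → ℝ)
    (hφ0 : ∀ y, 0 ≤ φ y)
    (hφint : Integrable φ)
    (hφrad : ∀ y₁ y₂ : EuclideanSpace ℝ (Fin d), ‖y₁‖ = ‖y₂‖ → φ y₁ = φ y₂)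
    (hφsupp : Function.support φ ⊆ Metric.closedBall 0 1)
    (ν : ℕ) (ξ : Fin ν → EuclideanSpace ℝ (Fin d)) (ω : Fin ν → ℝ)
    (hξ : ∀ j, ξ j ∈ Metric.closedBall (0 : EuclideanSpace ℝ (Fin d)) 1)
    (hω : ∀ j, 0 ≤ ω j)
    (hexact : ∀ (Q : Matrix (Fin d) (Fin d) ℝ) (b : Fin d → ℝ) (c : ℝ),
      (∑ j, ω j * ((∑ i, ∑ k, ξ j i * Q i k * ξ j k) + (∑ i, b i * ξ j i) + c) * φ (ξ j)) =
        ∫ y in Metric.ball (0 : EuclideanSpace ℝ (Fin d)) 1,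
          ((∑ i, ∑ k, y i * Q i k * y k) + (∑ i, b i * y i) + c) * φ y)
    (M : Matrix (Fin d) (Fin d) ℝ) (hMsym : M.IsSymm) (hMpos : M.PosDef)
    (ε : ℝ) (hε : 0 < ε) (s : ℝ) (hs : 0 < s) (hs1 : s ≤ 1) (K : ℝ) (hK : 0 ≤ K)
    (x : EuclideanSpace ℝ (Fin d))
    (w : EuclideanSpace ℝ (Fin d) → ℝ)
    (hwmeas : Measurable w) (hwbd : ∃ B : ℝ, ∀ x, |w x| ≤ B)
    (hP : ∃ (Q : Matrix (Fin d) (Fin d) ℝ) (b : Fin d → ℝ) (c : ℝ),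
      ∀ y : EuclideanSpace ℝ (Fin d),
        dist y x ≤ ε * ‖Matrix.toEuclideanCLM (𝕜 := ℝ) M‖ →
        |w y - ((∑ i, ∑ k, y i * Q i k * y k) + (∑ i, b i * y i) + c)| ≤
          K * ε ^ ((2 : ℝ) + s)) :
    |intOpBall φ ε M w x - intOpQuad φ ξ ω ε M w x| ≤
      8 * K * ε ^ s * ∫ y in Metric.ball (0 : EuclideanSpace ℝ (Fin d)) 1, φ y := by
  obtain ⟨Q, b, c, hP⟩ := hP
  obtain ⟨B, hB⟩ := hwbd
  obtain ⟨Q', b', c', hq⟩ := exists_quadratic_comp_affine Q M b c ε x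
  set q : EuclideanSpace ℝ (Fin d) → ℝ := fun y =>
    (∑ i, ∑ k, y i * Q' i k * y k) + (∑ i, b' i * y i) + (c' - w x) with hqdef
  set f : EuclideanSpace ℝ (Fin d) → ℝ := fun y =>
    w (x + ε • Matrix.toEuclideanLin M y) - w x with hfdef
  set E : ℝ := K * ε ^ ((2 : ℝ) + s) with hE
  set S := Metric.ball (0 : EuclideanSpace ℝ (Fin d)) 1
  have hfq : ∀ y ∈ Metric.closedBall (0 : EuclideanSpace ℝ (Fin d)) 1, |f y - q y| ≤ E := by
    intro y hy
    have hy1 : ‖y‖ ≤ 1 := by simpa using hy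
    have hMy : ‖Matrix.toEuclideanLin M y‖ ≤ ‖Matrix.toEuclideanCLM (𝕜 := ℝ) M‖ :=
      (Matrix.toEuclideanCLM (𝕜 := ℝ) M).unit_le_opNorm y hy1
    have h := hP (x + ε • Matrix.toEuclideanLin M y) (by
      rw [dist_eq_norm, add_sub_cancel_left, norm_smul, Real.norm_of_nonneg hε.le]
      exact mul_le_mul_of_nonneg_left hMy hε.le)
    rw [hq y] at h
    convert h using 2
    simp only [hfdef, hqdef]
    ring
  have hTcont : Continuous fun y => x + ε • Matrix.toEuclideanLin M y :=
    continuous_const.add ((Matrix.toEuclideanCLM (n := Fin d) (𝕜 := ℝ) M).continuous.const_smul ε)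
  have hfmeas : Measurable f := (hwmeas.comp hTcont.measurable).sub_const _
  have hfbd : ∀ y, |f y| ≤ B + B := fun y =>
    (abs_sub _ _).trans (add_le_add (hB _) (hB _))
  have hqcont : Continuous q := by fun_prop
  have hφS : Integrable φ (volume.restrict S) := hφint.restrict
  have hfint : Integrable (fun y => f y * φ y) (volume.restrict S) :=
    hφS.bdd_mul hfmeas.aestronglyMeasurable (Filter.Eventually.of_forall hfbd)
  have hdint : Integrable (fun y => (f y - q y) * φ y) (volume.restrict S) :=
    hφS.bdd_mul (c := E) (hfmeas.sub hqcont.measurable).aestronglyMeasurable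
      (ae_restrict_of_forall_mem Metric.isOpen_ball.measurableSet fun y hy =>
        hfq y (Metric.ball_subset_closedBall hy))
  have hqint : Integrable (fun y => q y * φ y) (volume.restrict S) := by
    refine (hfint.sub hdint).congr (Filter.Eventually.of_forall fun y => ?_)
    simp only [Pi.sub_apply]
    ring
  have hball : |∫ y in S, (f y - q y) * φ y| ≤ E * ∫ y in S, φ y := by
    rw [← integral_const_mul, ← Real.norm_eq_abs]
    refine norm_integral_le_of_norm_le (hφS.const_mul E)
      (ae_restrict_of_forall_mem Metric.isOpen_ball.measurableSet fun y hy => ?_)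
    rw [norm_mul, Real.norm_of_nonneg (hφ0 y)]
    exact mul_le_mul_of_nonneg_right (hfq y (Metric.ball_subset_closedBall hy)) (hφ0 y)
  have hmass : ∑ j, ω j * φ (ξ j) = ∫ y in S, φ y := by
    simpa using hexact 0 0 1
  have hquad : |∑ j, ω j * (f (ξ j) - q (ξ j)) * φ (ξ j)| ≤ E * ∫ y in S, φ y := by
    rw [← hmass, Finset.mul_sum]
    refine (Finset.abs_sum_le_sum_abs _ _).trans (Finset.sum_le_sum fun j _ => ?_)
    rw [abs_mul, abs_mul, abs_of_nonneg (hω j), abs_of_nonneg (hφ0 _)]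
    calc ω j * |f (ξ j) - q (ξ j)| * φ (ξ j)
        = |f (ξ j) - q (ξ j)| * (ω j * φ (ξ j)) := by ring
      _ ≤ E * (ω j * φ (ξ j)) :=
        mul_le_mul_of_nonneg_right (hfq _ (hξ j)) (mul_nonneg (hω j) (hφ0 _))
  have hdiff : intOpBall φ ε M w x - intOpQuad φ ξ ω ε M w x =
      2 / ε ^ 2 * ((∫ y in S, (f y - q y) * φ y) -
        ∑ j, ω j * (f (ξ j) - q (ξ j)) * φ (ξ j)) := by
    have hex : ∑ j, ω j * q (ξ j) * φ (ξ j) = ∫ y in S, q y * φ y := hexact Q' b' (c' - w x)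
    have hI : ∫ y in S, (f y - q y) * φ y = (∫ y in S, f y * φ y) - ∫ y in S, q y * φ y := by
      rw [← integral_sub hfint hqint]
      simp only [sub_mul]
    have hS : ∑ j, ω j * (f (ξ j) - q (ξ j)) * φ (ξ j) =
        (∑ j, ω j * f (ξ j) * φ (ξ j)) - ∑ j, ω j * q (ξ j) * φ (ξ j) := by
      rw [← Finset.sum_sub_distrib]
      simp only [mul_sub, sub_mul]
    rw [hI, hS, hex, sub_sub_sub_cancel_right, mul_sub]
    rfl
  have hE2 : 2 / ε ^ 2 * E = 2 * K * ε ^ s := by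
    rw [hE, Real.rpow_add hε, Real.rpow_two]
    field_simp
  have hφI : 0 ≤ ∫ y in S, φ y := integral_nonneg hφ0
  have hpos : 0 ≤ K * ε ^ s * ∫ y in S, φ y := by positivity
  rw [hdiff, abs_mul, abs_of_nonneg (by positivity : 0 ≤ 2 / ε ^ 2)]
  calc 2 / ε ^ 2 * |(∫ y in S, (f y - q y) * φ y) - ∑ j, ω j * (f (ξ j) - q (ξ j)) * φ (ξ j)|
      ≤ 2 / ε ^ 2 * (E * (∫ y in S, φ y) + E * ∫ y in S, φ y) :=
        mul_le_mul_of_nonneg_left ((abs_sub _ _).trans (add_le_add hball hquad)) (by positivity)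
    _ = 2 * (2 / ε ^ 2 * E) * ∫ y in S, φ y := by ring
    _ ≤ 8 * K * ε ^ s * ∫ y in S, φ y := by
        rw [hE2]
        linarith
end
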